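/- The graph F(9,15,30), defined as the simple graph on vertex set {1,...,9} with edge set {{1,4},{2,4},{2,5},{1,5},{3,6},{2,6},{2,7},{3,7},{4,6},{5,7},{8,9},{3,9},{3,8},{1,8},{1,9}}, is forbidden: there is no injective map φ : {1,...,9} → ℝ² with dist(φ(i), φ(j)) = 1 for every edge {i,j}. -/

import Mathlib

lemma aux_rhombus (a b c d x y : ℝ) (hu : a^2+b^2=1) (hv : c^2+d^2=1)
    (h1 : (x-a)^2+(y-b)^2=1) (h2 : (x-c)^2+(y-d)^2=1)
    (huv : ¬ (a = c ∧ b = d)) (hP : ¬ (x = 0 ∧ y = 0)) : x = a + c ∧ y = b + d := by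
  have e1 : x*(a-c)+y*(b-d)=0 := by linarith
  have e2 : (x-(a+c))*(a-c)+(y-(b+d))*(b-d)=0 := by linarith
  have e3 : x*(x-(a+c))+y*(y-(b+d))=0 := by linarith
  have c1 : (x*(y-(b+d))-y*(x-(a+c)))*(a-c)=0 := by
    linear_combination (y-(b+d))*e1 - y*e2
  have c2 : (x*(y-(b+d))-y*(x-(a+c)))*(b-d)=0 := by
    linear_combination -(x-(a+c))*e1 + x*e2
  have hc : x*(y-(b+d))-y*(x-(a+c)) = 0 := by
    by_contra hne
    apply huv
    constructor
    · have := (mul_eq_zero.mp c1).resolve_left hne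
      linarith
    · have := (mul_eq_zero.mp c2).resolve_left hne
      linarith
  have hn : 0 < x^2+y^2 := by
    by_contra hle
    apply hP
    constructor <;> nlinarith [sq_nonneg x, sq_nonneg y]
  have f1 : (x^2+y^2)*(x-(a+c)) = 0 := by
    linear_combination x*e3 - y*hc
  have f2 : (x^2+y^2)*(y-(b+d)) = 0 := by
    linear_combination y*e3 + x*hc
  constructor
  · have := (mul_eq_zero.mp f1).resolve_left hn.ne'
    linarith
  · have := (mul_eq_zero.mp f2).resolve_left hn.ne'
    linarith

lemma aux_rot (a b c d : ℝ) (hu : a^2+b^2=1) (hv : c^2+d^2=1) (h : (a-c)^2+(b-d)^2=1) :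
    ∃ t : ℝ, t^2 = 3/4 ∧ c = a/2 - t*b ∧ d = b/2 + t*a := by
  have hd : a*c+b*d = 1/2 := by linarith
  refine ⟨a*d-b*c, ?_, ?_, ?_⟩
  · linear_combination (c^2+d^2)*hu + hv - (a*c+b*d+1/2)*hd
  · linear_combination a*hd - c*hu
  · linear_combination b*hd - d*hu

lemma aux_sum (a b c d : ℝ) (hu : a^2+b^2=1) (hv : c^2+d^2=1) (h : (a+c)^2+(b+d)^2=3) :
    ∃ t : ℝ, t^2 = 3/4 ∧ c = a/2 - t*b ∧ d = b/2 + t*a :=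
  aux_rot a b c d hu hv (by linarith)

lemma aux_main (a b c d e f g h : ℝ) (h4 : a^2+b^2=1) (h5 : c^2+d^2=1)
    (h6 : e^2+f^2=1) (h7 : g^2+h^2=1)
    (h46 : (a-e)^2+(b-f)^2=1) (h57 : (c-g)^2+(d-h)^2=1)
    (h13 : (a+c-(e+g))^2+(b+d-(f+h))^2=3)
    (n56 : ¬ (c = e ∧ d = f)) (n47 : ¬ (a = g ∧ b = h))
    (n12 : ¬ (a + c = 0 ∧ b + d = 0)) (n32 : ¬ (e + g = 0 ∧ f + h = 0)) : False := by
  obtain ⟨t, ht, rfl, rfl⟩ := aux_rot a b e f h4 h6 h46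
  obtain ⟨s, hs, rfl, rfl⟩ := aux_rot c d g h h5 h7 h57
  have hst : s = t ∨ s = -t := sq_eq_sq_iff_eq_or_eq_neg.mp (by rw [hs, ht])
  rcases hst with rfl | rfl
  · have : (a+c)^2+(b+d)^2=3 := by
      linear_combination h13 - ((a+c)^2+(b+d)^2)*ht
    obtain ⟨r, hr, rfl, rfl⟩ := aux_sum a b c d h4 h5 this
    have : r = s ∨ r = -s := sq_eq_sq_iff_eq_or_eq_neg.mp (by rw [hs, hr])
    rcases this with rfl | rfl
    · exact n56 ⟨rfl, rfl⟩
    · apply n47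
      constructor
      · linear_combination -a*hs
      · linear_combination -b*hs
  · -- the differences are the opposite rotations of the two vectors
    have h3 : ((a/2+t*b)+(c/2-t*d))^2+((b/2-t*a)+(d/2+t*c))^2=3 := by
      linear_combination h13
    obtain ⟨r, hr, e1, e2⟩ := aux_sum (a/2+t*b) (b/2-t*a) (c/2-t*d) (d/2+t*c)
      (by linear_combination h4 + (a^2+b^2)*ht) (by linear_combination h5 + (c^2+d^2)*ht) h3
    have : r = t ∨ r = -t := sq_eq_sq_iff_eq_or_eq_neg.mp (by rw [ht, hr])
    -- invert the rotation
    have k1 : c = (c/2-t*d)/2 + t*(d/2+t*c) := by linear_combination -c*ht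
    have k2 : d = (d/2+t*c)/2 - t*(c/2-t*d) := by linear_combination -d*ht
    rw [e1, e2] at k1 k2
    rcases this with rfl | rfl
    · apply n32
      have q1 : c = a/2 + r*b := by rw [k1]; linear_combination (a/2 + r * b)*ht
      have q2 : d = b/2 - r*a := by rw [k2]; linear_combination (b/2 - r * a)*ht
      rw [q1, q2]
      constructor
      · linear_combination -a*ht
      · linear_combination -b*ht
    · apply n12
      constructor
      · rw [k1]; linear_combination (-3*a/2-t*b)*ht
      · rw [k2]; linear_combination (-3*b/2+t*a)*ht

lemma aux_dist (p q : EuclideanSpace ℝ (Fin 2)) (h : dist p q = 1) :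
    (p 0 - q 0)^2 + (p 1 - q 1)^2 = 1 := by
  rw [EuclideanSpace.dist_eq, Real.sqrt_eq_one, Fin.sum_univ_two, Real.dist_eq, Real.dist_eq,
    sq_abs, sq_abs] at h
  exact h

lemma aux_ne (p q : EuclideanSpace ℝ (Fin 2)) (h : p ≠ q) : ¬ (p 0 = q 0 ∧ p 1 = q 1) := by
  rintro ⟨h0, h1⟩
  apply h
  ext i
  fin_cases i
  · exact h0
  · exact h1

theorem F_9_15_30_forbidden :
    ¬ ∃ φ : ℕ → EuclideanSpace ℝ (Fin 2),
      Set.InjOn φ (Set.Icc 1 9) ∧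
      dist (φ 1) (φ 4) = 1 ∧
      dist (φ 2) (φ 4) = 1 ∧
      dist (φ 2) (φ 5) = 1 ∧
      dist (φ 1) (φ 5) = 1 ∧
      dist (φ 3) (φ 6) = 1 ∧
      dist (φ 2) (φ 6) = 1 ∧
      dist (φ 2) (φ 7) = 1 ∧
      dist (φ 3) (φ 7) = 1 ∧
      dist (φ 4) (φ 6) = 1 ∧
      dist (φ 5) (φ 7) = 1 ∧
      dist (φ 8) (φ 9) = 1 ∧
      dist (φ 3) (φ 9) = 1 ∧
      dist (φ 3) (φ 8) = 1 ∧
      dist (φ 1) (φ 8) = 1 ∧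
      dist (φ 1) (φ 9) = 1 := by
  rintro ⟨φ, hinj, h14, h24, h25, h15, h36, h26, h27, h37, h46, h57, h89, h39, h38, h18, h19⟩
  have ne : ∀ i j : ℕ, 1 ≤ i → i ≤ 9 → 1 ≤ j → j ≤ 9 → i ≠ j →
      ¬ (φ i 0 = φ j 0 ∧ φ i 1 = φ j 1) := by
    intro i j hi hi' hj hj' hij
    exact aux_ne _ _ fun h => hij (hinj ⟨hi, hi'⟩ ⟨hj, hj'⟩ h)
  have n12 := ne 1 2 (by norm_num) (by norm_num) (by norm_num) (by norm_num) (by norm_num)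
  have n32 := ne 3 2 (by norm_num) (by norm_num) (by norm_num) (by norm_num) (by norm_num)
  have n31 := ne 3 1 (by norm_num) (by norm_num) (by norm_num) (by norm_num) (by norm_num)
  have n45 := ne 4 5 (by norm_num) (by norm_num) (by norm_num) (by norm_num) (by norm_num)
  have n67 := ne 6 7 (by norm_num) (by norm_num) (by norm_num) (by norm_num) (by norm_num)
  have n89 := ne 8 9 (by norm_num) (by norm_num) (by norm_num) (by norm_num) (by norm_num)
  have n56 := ne 5 6 (by norm_num) (by norm_num) (by norm_num) (by norm_num) (by norm_num)
  have n47 := ne 4 7 (by norm_num) (by norm_num) (by norm_num) (by norm_num) (by norm_num)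
  clear ne hinj
  replace h14 := aux_dist _ _ h14
  replace h24 := aux_dist _ _ h24
  replace h25 := aux_dist _ _ h25
  replace h15 := aux_dist _ _ h15
  replace h36 := aux_dist _ _ h36
  replace h26 := aux_dist _ _ h26
  replace h27 := aux_dist _ _ h27
  replace h37 := aux_dist _ _ h37
  replace h46 := aux_dist _ _ h46
  replace h57 := aux_dist _ _ h57
  replace h89 := aux_dist _ _ h89
  replace h39 := aux_dist _ _ h39
  replace h38 := aux_dist _ _ h38
  replace h18 := aux_dist _ _ h18
  replace h19 := aux_dist _ _ h19
  have tr : ∀ {p q r s o o' : ℝ}, ¬ (p = q ∧ r = s) → ¬ (p - o = q - o ∧ r - o' = s - o') := by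
    rintro p q r s o o' hn ⟨u, v⟩
    exact hn ⟨by linarith, by linarith⟩
  have tr0 : ∀ {p q r s : ℝ}, ¬ (p = q ∧ r = s) → ¬ (p - q = 0 ∧ r - s = 0) := by
    rintro p q r s hn ⟨u, v⟩
    exact hn ⟨by linarith, by linarith⟩
  obtain ⟨x1, y1⟩ := aux_rhombus (φ 4 0 - φ 2 0) (φ 4 1 - φ 2 1) (φ 5 0 - φ 2 0) (φ 5 1 - φ 2 1)
    (φ 1 0 - φ 2 0) (φ 1 1 - φ 2 1) (by linarith) (by linarith) (by linarith) (by linarith)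
    (tr n45) (tr0 n12)
  obtain ⟨x3, y3⟩ := aux_rhombus (φ 6 0 - φ 2 0) (φ 6 1 - φ 2 1) (φ 7 0 - φ 2 0) (φ 7 1 - φ 2 1)
    (φ 3 0 - φ 2 0) (φ 3 1 - φ 2 1) (by linarith) (by linarith) (by linarith) (by linarith)
    (tr n67) (tr0 n32)
  obtain ⟨x, y⟩ := aux_rhombus (φ 8 0 - φ 1 0) (φ 8 1 - φ 1 1) (φ 9 0 - φ 1 0) (φ 9 1 - φ 1 1)
    (φ 3 0 - φ 1 0) (φ 3 1 - φ 1 1) (by linarith) (by linarith) (by linarith) (by linarith)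
    (tr n89) (tr0 n31)
  have h13 : (φ 3 0 - φ 1 0)^2 + (φ 3 1 - φ 1 1)^2 = 3 := by
    rw [x, y]; linarith
  refine aux_main (φ 4 0 - φ 2 0) (φ 4 1 - φ 2 1) (φ 5 0 - φ 2 0) (φ 5 1 - φ 2 1)
    (φ 6 0 - φ 2 0) (φ 6 1 - φ 2 1) (φ 7 0 - φ 2 0) (φ 7 1 - φ 2 1)
    (by linarith) (by linarith) (by linarith) (by linarith) (by linarith) (by linarith)
    ?_ (tr n56) (tr n47) ?_ ?_
  · rw [← x1, ← y1, ← x3, ← y3]; linarith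
  · rw [← x1, ← y1]; exact tr0 n12
  · rw [← x3, ← y3]; exact tr0 n32
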